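/- The bivariate generating function D^{3,4}(z,w) of dissections into triangles and quadrilaterals satisfies D^{3,4} = 1 + w·z·(D^{3,4})^2 + w·z^2·(D^{3,4})^3 as formal power series. -/

import Mathlib

namespace PolygonDissection

/-- The cyclic successor of a vertex of the `N`-gon. -/
def cyc {N : ℕ} (i : Fin N) : Fin N := ⟨(i.val + 1) % N, Nat.mod_lt _ i.pos⟩

/-- `e` is a side of the convex `N`-gon: a pair of cyclically adjacent vertices. -/
def IsSide (N : ℕ) (e : Finset (Fin N)) : Prop :=
  ∃ i : Fin N, i ≠ cyc i ∧ e = {i, cyc i}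

/-- `e` is a diagonal of the convex `N`-gon. -/
def IsDiag (N : ℕ) (e : Finset (Fin N)) : Prop :=
  e.card = 2 ∧ ¬ IsSide N e

/-- Two chords of the convex `N`-gon cross in the interior. -/
def Crosses (N : ℕ) (e f : Finset (Fin N)) : Prop :=
  ∃ a b c d : Fin N, a < c ∧ c < b ∧ b < d ∧
    ((e = {a, b} ∧ f = {c, d}) ∨ (e = {c, d} ∧ f = {a, b}))

/-- A dissection of the convex `N`-gon: a set of pairwise non-crossing diagonals. -/
def IsDissection (N : ℕ) (S : Finset (Finset (Fin N))) : Prop :=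
  (∀ e ∈ S, IsDiag N e) ∧ ∀ e ∈ S, ∀ f ∈ S, ¬ Crosses N e f

/-- `y` is the cyclic successor of `x` among the vertices of `c`. -/
def IsNext {N : ℕ} (c : Finset (Fin N)) (x y : Fin N) : Prop :=
  x ∈ c ∧ y ∈ c ∧ y ≠ x ∧ ∀ z ∈ c, z ≠ x → (y - x).val ≤ (z - x).val

/-- `c` (a set of polygon vertices) is a cell of the dissection `S`:
each pair of cyclically consecutive vertices of `c` is joined by a side of the
polygon or a diagonal of `S`, and no diagonal of `S` is an interior chord of `c`. -/
def IsCell (N : ℕ) (S : Finset (Finset (Fin N))) (c : Finset (Fin N)) : Prop :=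
  3 ≤ c.card ∧
  (∀ x y : Fin N, IsNext c x y → IsSide N {x, y} ∨ {x, y} ∈ S) ∧
  (∀ e ∈ S, e ⊆ c → ∃ x y, e = ({x, y} : Finset (Fin N)) ∧ (IsNext c x y ∨ IsNext c y x))

/-- The number of cells of the dissection `S`. -/
noncomputable def numCells (N : ℕ) (S : Finset (Finset (Fin N))) : ℕ :=
  {c : Finset (Fin N) | IsCell N S c}.ncard

/-- The quiddity of the dissection `S`: its `i`-th entry is the number of
cells containing the `i`-th vertex. -/
noncomputable def quiddity (N : ℕ) (S : Finset (Finset (Fin N))) (i : Fin N) : ℕ :=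
  {c : Finset (Fin N) | IsCell N S c ∧ i ∈ c}.ncard


/-- `D34 n m` is the number of dissections of a convex `(n+2)`-gon into `m`
cells, each a triangle or a quadrilateral. -/
noncomputable def D34 (n m : ℕ) : ℕ :=
  {S : Finset (Finset (Fin (n + 2))) | IsDissection (n + 2) S ∧
      (∀ c : Finset (Fin (n + 2)), IsCell (n + 2) S c → c.card = 3 ∨ c.card = 4) ∧
      numCells (n + 2) S = m}.ncard

/-- The bivariate generating function of `D34`. -/
noncomputable def D34gf : MvPowerSeries (Fin 2) ℚ :=
  fun d => (D34 (d 0) (d 1) : ℚ)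

/-- Pairwise non-crossing. -/
def NC (T : Finset (ℕ × ℕ)) : Prop :=
  ∀ a b c d, (a, b) ∈ T → (c, d) ∈ T → a < c → c < b → b < d → False

/-- `x` is strictly covered by a chord of `T` properly inside `[i,j]`. -/
def Cov (T : Finset (ℕ × ℕ)) (i j x : ℕ) : Prop :=
  ∃ k l, (k, l) ∈ T ∧ i ≤ k ∧ l ≤ j ∧ (k, l) ≠ (i, j) ∧ k < x ∧ x < l

open Classical in
/-- the cell below the chord `(i,j)`. -/
noncomputable def ccell (T : Finset (ℕ × ℕ)) (i j : ℕ) : Finset ℕ :=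
  (Finset.Icc i j).filter (fun x => ¬ Cov T i j x)

theorem mem_ccell {T : Finset (ℕ × ℕ)} {i j x : ℕ} :
    x ∈ ccell T i j ↔ (i ≤ x ∧ x ≤ j) ∧ ¬ Cov T i j x := by
  classical
  simp [ccell]

theorem left_mem {T : Finset (ℕ × ℕ)} {i j : ℕ} (h : i ≤ j) : i ∈ ccell T i j := by
  rw [mem_ccell]
  refine ⟨⟨le_rfl, h⟩, ?_⟩
  rintro ⟨k, l, _, _, _, _, _, _⟩
  omega

theorem right_mem {T : Finset (ℕ × ℕ)} {i j : ℕ} (h : i ≤ j) : j ∈ ccell T i j := by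
  rw [mem_ccell]
  refine ⟨⟨h, le_rfl⟩, ?_⟩
  rintro ⟨k, l, _, _, _, _, _, _⟩
  omega

theorem consec {T : Finset (ℕ × ℕ)} {i j u v : ℕ} (hT : NC T)
    (hu : u ∈ ccell T i j) (hv : v ∈ ccell T i j) (huv : u + 2 ≤ v)
    (hb : ∀ z ∈ ccell T i j, u < z → z < v → False) :
    (u, v) ∈ T ∧ (u, v) ≠ (i, j) := by
  classical
  rw [mem_ccell] at hu hv
  obtain ⟨⟨hu1, hu2⟩, hu3⟩ := hu
  obtain ⟨⟨hv1, hv2⟩, hv3⟩ := hv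
  have cov : ∀ z, u < z → z < v → Cov T i j z := by
    intro z h1 h2
    by_contra h
    exact hb z (mem_ccell.2 ⟨⟨by omega, by omega⟩, h⟩) h1 h2
  have key : ∀ k l z, (k, l) ∈ T → i ≤ k → l ≤ j → (k, l) ≠ (i, j) → k < z → z < l →
      u < z → z < v → u ≤ k ∧ l ≤ v := by
    intro k l z h1 h2 h3 h4 h5 h6 h7 h8
    constructor
    · by_contra h
      exact hu3 ⟨k, l, h1, h2, h3, h4, by omega, by omega⟩
    · by_contra h
      exact hv3 ⟨k, l, h1, h2, h3, h4, by omega, by omega⟩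
  let P : ℕ → Prop := fun l => (u, l) ∈ T ∧ (u, l) ≠ (i, j) ∧ u + 1 < l ∧ l ≤ v
  obtain ⟨k, l, h1, h2, h3, h4, h5, h6⟩ := cov (u + 1) (by omega) (by omega)
  have hk := key k l (u+1) h1 h2 h3 h4 h5 h6 (by omega) (by omega)
  obtain rfl : k = u := by omega
  have hP : P l := ⟨h1, h4, h6, hk.2⟩
  have hs : P (Nat.findGreatest P v) := Nat.findGreatest_spec hk.2 hP
  have hg : ∀ n, Nat.findGreatest P v < n → n ≤ v → ¬ P n := fun n => Nat.findGreatest_is_greatest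
  set M := Nat.findGreatest P v
  obtain ⟨g1, g2, g3, g4⟩ := hs
  rcases Nat.lt_or_ge M v with hlt | hge
  · exfalso
    obtain ⟨k', l', e1, e2, e3, e4, e5, e6⟩ := cov M (by omega) hlt
    have hk' := key k' l' M e1 e2 e3 e4 e5 e6 (by omega) hlt
    rcases Nat.lt_or_ge k k' with h | h
    · exact hT _ _ _ _ g1 e1 h e5 e6
    · obtain rfl : k = k' := by omega
      exact hg l' e6 hk'.2 ⟨e1, e4, by omega, hk'.2⟩
  · have hM : M = v := by omega
    rw [hM] at g1 g2
    exact ⟨g1, g2⟩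

/-- Intrinsic characterization of cells. -/
def Cell' (T : Finset (ℕ × ℕ)) (c : Finset ℕ) : Prop :=
  3 ≤ c.card ∧ ∃ p q, p ∈ c ∧ q ∈ c ∧ (∀ z ∈ c, p ≤ z ∧ z ≤ q) ∧ (p, q) ∈ T ∧
    (∀ u ∈ c, ∀ v ∈ c, u < v → (∀ z ∈ c, u < z → z < v → False) → v = u + 1 ∨ (u, v) ∈ T) ∧
    (∀ k l, (k, l) ∈ T → k ∈ c → l ∈ c → (k, l) = (p, q) ∨ (∀ z ∈ c, k < z → z < l → False))

theorem gap {c : Finset ℕ} {p q x : ℕ} (hp : p ∈ c) (hq : q ∈ c) (hpx : p ≤ x) (hxq : x ≤ q)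
    (hx : x ∉ c) : ∃ u ∈ c, ∃ v ∈ c, u < x ∧ x < v ∧ (∀ z ∈ c, z ≤ u ∨ v ≤ z) := by
  classical
  have hpx' : p ≠ x := fun h => hx (h ▸ hp)
  have hqx' : q ≠ x := fun h => hx (h ▸ hq)
  obtain ⟨u, hu, hu'⟩ := (c.filter (· < x)).exists_max_image id
    ⟨p, Finset.mem_filter.2 ⟨hp, by omega⟩⟩
  obtain ⟨v, hv, hv'⟩ := (c.filter (x < ·)).exists_min_image id
    ⟨q, Finset.mem_filter.2 ⟨hq, by omega⟩⟩
  simp only [Finset.mem_filter, id] at *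
  refine ⟨u, hu.1, v, hv.1, hu.2, hv.2, ?_⟩
  intro z hz
  have : z ≠ x := fun h => hx (h ▸ hz)
  rcases Nat.lt_or_gt_of_ne this with h | h
  · exact Or.inl (hu' z ⟨hz, h⟩)
  · exact Or.inr (hv' z ⟨hz, h⟩)

theorem cell'_iff {T : Finset (ℕ × ℕ)} (hT : NC T) (h2 : ∀ i j, (i, j) ∈ T → i + 2 ≤ j)
    (c : Finset ℕ) : Cell' T c ↔ ∃ i j, (i, j) ∈ T ∧ ccell T i j = c := by
  constructor
  · rintro ⟨hc, p, q, hp, hq, hpq, hT1, hcon, hch⟩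
    refine ⟨p, q, hT1, ?_⟩
    ext x
    rw [mem_ccell]
    constructor
    · rintro ⟨⟨hx1, hx2⟩, hx3⟩
      by_contra hx
      obtain ⟨u, hu, v, hv, hux, hxv, hg⟩ := gap hp hq hx1 hx2 hx
      apply hx3
      refine ⟨u, v, ?_, (hpq u hu).1, (hpq v hv).2, ?_, hux, hxv⟩
      · rcases hcon u hu v hv (by omega) (fun z hz _ _ => by have := hg z hz; omega) with h | h
        · omega
        · exact h
      · intro he
        simp only [Prod.mk.injEq] at he
        obtain ⟨rfl, rfl⟩ := he
        have : c ⊆ {u, v} := by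
          intro z hz
          have := hg z hz
          have := hpq z hz
          simp; omega
        have := Finset.card_le_card this
        have := Finset.card_le_two (a := u) (b := v)
        omega
    · intro hx
      refine ⟨hpq x hx, ?_⟩
      rintro ⟨k, l, h1, h3, h4, h5, h6, h7⟩
      by_cases hk : k ∈ c
      · by_cases hl : l ∈ c
        · rcases hch k l h1 hk hl with h | h
          · exact h5 h
          · exact h x hx h6 h7
        · obtain ⟨u, hu, v, hv, hux, hxv, hg⟩ := gap hp hq (by have := hpq k hk; omega) h4 hl
          have hgx := hg x hx
          rcases hcon u hu v hv (by omega) (fun z hz _ _ => by have := hg z hz; omega) with h | h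
          · omega
          · exact hT _ _ _ _ h1 h (by omega) hux hxv
      · obtain ⟨u, hu, v, hv, hux, hxv, hg⟩ := gap hp hq h3 (by have := hpq x hx; omega) hk
        have hgx := hg x hx
        rcases hcon u hu v hv (by omega) (fun z hz _ _ => by have := hg z hz; omega) with h | h
        · omega
        · exact hT _ _ _ _ h h1 hux hxv (by omega)
  · rintro ⟨i, j, hij, rfl⟩
    have hij2 := h2 i j hij
    have hi := left_mem (T := T) (i := i) (j := j) (by omega)
    have hj := right_mem (T := T) (i := i) (j := j) (by omega)
    have h3 : ∃ z ∈ ccell T i j, i < z ∧ z < j := by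
      by_contra h
      push Not at h
      exact (consec hT hi hj hij2 (fun z hz h1 h2 => by have := h z hz h1; omega)).2 rfl
    refine ⟨?_, i, j, hi, hj, fun z hz => (mem_ccell.1 hz).1, hij, ?_, ?_⟩
    · obtain ⟨z, hz, h1, h2⟩ := h3
      have : ({i, z, j} : Finset ℕ) ⊆ ccell T i j := by
        intro w hw
        simp only [Finset.mem_insert, Finset.mem_singleton] at hw
        rcases hw with rfl | rfl | rfl <;> assumption
      refine le_trans ?_ (Finset.card_le_card this)
      rw [Finset.card_eq_three.2 ⟨i, z, j, by omega, by omega, by omega, rfl⟩]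
    · intro u hu v hv huv hb
      by_cases h : v = u + 1
      · exact Or.inl h
      · exact Or.inr (consec hT hu hv (by omega) hb).1
    · intro k l hkl hk hl
      by_cases h : (k, l) = (i, j)
      · exact Or.inl h
      · right
        intro z hz h1 h2
        have hk' := (mem_ccell.1 hk).1
        have hl' := (mem_ccell.1 hl).1
        exact (mem_ccell.1 hz).2 ⟨k, l, hkl, by omega, by omega, h, h1, h2⟩

theorem ccell_inj {T : Finset (ℕ × ℕ)} {i j i' j' : ℕ} (h : i ≤ j) (h' : i' ≤ j')
    (he : ccell T i j = ccell T i' j') : i = i' ∧ j = j' := by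
  have h1 := (mem_ccell.1 (he ▸ left_mem (T := T) h)).1
  have h2 := (mem_ccell.1 (he ▸ right_mem (T := T) h)).1
  have h3 := (mem_ccell.1 (he.symm ▸ left_mem (T := T) h')).1
  have h4 := (mem_ccell.1 (he.symm ▸ right_mem (T := T) h')).1
  omega

def Bd (a b : ℕ) (T : Finset (ℕ × ℕ)) : Prop :=
  ∀ i j, (i, j) ∈ T → a ≤ i ∧ i + 2 ≤ j ∧ j ≤ b

def Gd (a b : ℕ) (T : Finset (ℕ × ℕ)) : Prop :=
  Bd a b T ∧ NC T ∧ ∀ i j, (i, j) ∈ T → (ccell T i j).card = 3 ∨ (ccell T i j).card = 4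

def Fd (a b : ℕ) (T : Finset (ℕ × ℕ)) : Prop :=
  Gd a b T ∧ a < b ∧ (a + 2 ≤ b → (a, b) ∈ T)

def Un (T : Finset (ℕ × ℕ)) (x : ℕ) : Prop :=
  ∀ k l, (k, l) ∈ T → k < x → x < l → False

theorem ccell_congr {T T' : Finset (ℕ × ℕ)} {i j : ℕ}
    (h : ∀ k l, i ≤ k → k < l → l ≤ j → (k, l) ≠ (i, j) → ((k, l) ∈ T ↔ (k, l) ∈ T')) :
    ccell T i j = ccell T' i j := by
  ext x
  rw [mem_ccell, mem_ccell]
  refine and_congr_right fun _ => not_congr ?_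
  constructor
  · rintro ⟨k, l, h1, h2, h3, h4, h5, h6⟩
    exact ⟨k, l, (h k l h2 (by omega) h3 h4).1 h1, h2, h3, h4, h5, h6⟩
  · rintro ⟨k, l, h1, h2, h3, h4, h5, h6⟩
    exact ⟨k, l, (h k l h2 (by omega) h3 h4).2 h1, h2, h3, h4, h5, h6⟩

theorem mem_root {a b : ℕ} {T U : Finset (ℕ × ℕ)} (hU : Bd a b U) (hr : (a, b) ∉ U)
    (hT : T = insert (a, b) U) (x : ℕ) :
    x ∈ ccell T a b ↔ (a ≤ x ∧ x ≤ b) ∧ Un U x := by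
  rw [mem_ccell]
  refine and_congr_right fun _ => ?_
  constructor
  · intro h k l h1 h2 h3
    have := hU k l h1
    exact h ⟨k, l, by simp [hT, h1], this.1, this.2.2, fun e => hr (e ▸ h1), h2, h3⟩
  · rintro h ⟨k, l, h1, h2, h3, h4, h5, h6⟩
    rw [hT, Finset.mem_insert] at h1
    exact h k l (h1.resolve_left h4) h5 h6

theorem add_root {a b : ℕ} {U : Finset (ℕ × ℕ)} (hU : Gd a b U) (hr : (a, b) ∉ U)
    (hab : a + 2 ≤ b)
    (hc : (ccell (insert (a, b) U) a b).card = 3 ∨ (ccell (insert (a, b) U) a b).card = 4) :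
    Fd a b (insert (a, b) U) := by
  obtain ⟨h1, h2, h3⟩ := hU
  refine ⟨⟨?_, ?_, ?_⟩, by omega, fun _ => Finset.mem_insert_self _ _⟩
  · intro i j h
    simp only [Finset.mem_insert, Prod.mk.injEq] at h
    rcases h with h | h
    · omega
    · exact h1 _ _ h
  · intro p q r s hp hr' h4 h5 h6
    simp only [Finset.mem_insert, Prod.mk.injEq] at hp hr'
    rcases hp with hp | hp
    · rcases hr' with hr' | hr'
      · omega
      · have := h1 _ _ hr'; omega
    · rcases hr' with hr' | hr'
      · have := h1 _ _ hp; omega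
      · exact h2 _ _ _ _ hp hr' h4 h5 h6
  · intro i j h
    rcases Finset.mem_insert.1 h with h | h
    · simp only [Prod.mk.injEq] at h
      obtain ⟨rfl, rfl⟩ := h
      exact hc
    · rw [ccell_congr (T' := U)]
      · exact h3 i j h
      · intro k l hk hkl hl hne
        have hb := h1 i j h
        rw [Finset.mem_insert]
        refine or_iff_right ?_
        intro he
        simp only [Prod.mk.injEq] at he
        obtain ⟨rfl, rfl⟩ := he
        have e1 : i = k := by omega
        have e2 : j = l := by omega
        subst e1; subst e2
        exact hne rfl

theorem del_root {a b : ℕ} {T : Finset (ℕ × ℕ)} (hT : Fd a b T) (hab : a + 2 ≤ b) :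
    Gd a b (T.erase (a, b)) ∧ (a, b) ∉ T.erase (a, b) ∧ T = insert (a, b) (T.erase (a, b)) ∧
      ((ccell T a b).card = 3 ∨ (ccell T a b).card = 4) := by
  obtain ⟨⟨h1, h2, h3⟩, h4, h5⟩ := hT
  refine ⟨⟨?_, ?_, ?_⟩, Finset.notMem_erase _ _, (Finset.insert_erase (h5 hab)).symm,
    h3 _ _ (h5 hab)⟩
  · intro i j h
    exact h1 i j (Finset.mem_of_mem_erase h)
  · intro p q r s hp hr
    exact h2 p q r s (Finset.mem_of_mem_erase hp) (Finset.mem_of_mem_erase hr)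
  · intro i j h
    rw [ccell_congr (T' := T)]
    · exact h3 i j (Finset.mem_of_mem_erase h)
    · intro k l hk hkl hl hne
      have hb := h1 i j (Finset.mem_of_mem_erase h)
      rw [Finset.mem_erase]
      refine and_iff_right ?_
      intro he
      simp only [Prod.mk.injEq] at he
      obtain ⟨rfl, rfl⟩ := he
      have e1 : i = k := by omega
      have e2 : j = l := by omega
      subst e1; subst e2
      exact hne rfl

theorem glue {a x b : ℕ} {T U : Finset (ℕ × ℕ)} (hax : a ≤ x) (hxb : x ≤ b)
    (hT : Gd a x T) (hU : Gd x b U) : Gd a b (T ∪ U) := by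
  obtain ⟨h1, h2, h3⟩ := hT
  obtain ⟨g1, g2, g3⟩ := hU
  refine ⟨?_, ?_, ?_⟩
  · intro i j h
    rcases Finset.mem_union.1 h with h | h
    · have := h1 i j h; omega
    · have := g1 i j h; omega
  · intro p q r s hp hr e1 e2 e3
    rcases Finset.mem_union.1 hp with hp | hp <;> rcases Finset.mem_union.1 hr with hr | hr
    · exact h2 _ _ _ _ hp hr e1 e2 e3
    · have := h1 _ _ hp; have := g1 _ _ hr; omega
    · have := g1 _ _ hp; have := h1 _ _ hr; omega
    · exact g2 _ _ _ _ hp hr e1 e2 e3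
  · intro i j h
    rcases Finset.mem_union.1 h with h | h
    · rw [ccell_congr (T' := T)]
      · exact h3 i j h
      · intro k l hk hkl hl hne
        rw [Finset.mem_union]
        refine or_iff_left ?_
        intro he
        have := h1 _ _ h; have := g1 _ _ he; omega
    · rw [ccell_congr (T' := U)]
      · exact g3 i j h
      · intro k l hk hkl hl hne
        rw [Finset.mem_union]
        refine or_iff_right ?_
        intro he
        have := g1 _ _ h; have := h1 _ _ he; omega

theorem un_union {T U : Finset (ℕ × ℕ)} (x : ℕ) : Un (T ∪ U) x ↔ Un T x ∧ Un U x := by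
  constructor
  · intro h
    exact ⟨fun k l hk => h k l (Finset.mem_union_left _ hk),
      fun k l hk => h k l (Finset.mem_union_right _ hk)⟩
  · rintro ⟨h1, h2⟩ k l hk
    rcases Finset.mem_union.1 hk with h | h
    · exact h1 k l h
    · exact h2 k l h

theorem un_out {a b x : ℕ} {T : Finset (ℕ × ℕ)} (hT : Bd a b T) (hx : x ≤ a ∨ b ≤ x) : Un T x := by
  intro k l hk h1 h2
  have := hT k l hk
  omega

theorem split {a x b : ℕ} {U : Finset (ℕ × ℕ)} (hU : Gd a b U) (hx : Un U x) :
    Gd a x (U.filter (fun e => e.2 ≤ x)) ∧ Gd x b (U.filter (fun e => x ≤ e.1)) ∧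
      U = U.filter (fun e => e.2 ≤ x) ∪ U.filter (fun e => x ≤ e.1) := by
  obtain ⟨h1, h2, h3⟩ := hU
  refine ⟨⟨?_, ?_, ?_⟩, ⟨?_, ?_, ?_⟩, ?_⟩
  · intro i j h
    have h' := Finset.mem_filter.1 h
    have := h1 i j h'.1
    have := h'.2
    simp only at this
    omega
  · intro p q r s hp hr
    exact h2 p q r s (Finset.mem_filter.1 hp).1 (Finset.mem_filter.1 hr).1
  · intro i j h
    have h' := Finset.mem_filter.1 h
    rw [ccell_congr (T' := U)]
    · exact h3 i j h'.1
    · intro k l hk hkl hl hne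
      have := h'.2
      simp only [Finset.mem_filter] at *
      refine and_iff_left ?_
      omega
  · intro i j h
    have h' := Finset.mem_filter.1 h
    have := h1 i j h'.1
    have := h'.2
    simp only at this
    omega
  · intro p q r s hp hr
    exact h2 p q r s (Finset.mem_filter.1 hp).1 (Finset.mem_filter.1 hr).1
  · intro i j h
    have h' := Finset.mem_filter.1 h
    rw [ccell_congr (T' := U)]
    · exact h3 i j h'.1
    · intro k l hk hkl hl hne
      have := h'.2
      simp only [Finset.mem_filter] at *
      refine and_iff_left ?_
      omega
  · ext ⟨k, l⟩
    simp only [Finset.mem_union, Finset.mem_filter]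
    constructor
    · intro h
      by_cases hl : l ≤ x
      · exact Or.inl ⟨h, hl⟩
      · right
        refine ⟨h, ?_⟩
        by_contra hk
        exact hx k l h (by omega) (by omega)
    · rintro (h | h) <;> exact h.1

theorem filter_glue {a x b : ℕ} {T U : Finset (ℕ × ℕ)} (hT : Bd a x T) (hU : Bd x b U) :
    (T ∪ U).filter (fun e => e.2 ≤ x) = T ∧ (T ∪ U).filter (fun e => x ≤ e.1) = U := by
  constructor
  · ext ⟨k, l⟩
    simp only [Finset.mem_union, Finset.mem_filter]
    constructor
    · rintro ⟨h | h, h'⟩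
      · exact h
      · have := hU _ _ h; omega
    · intro h
      have := hT _ _ h
      exact ⟨Or.inl h, by omega⟩
  · ext ⟨k, l⟩
    simp only [Finset.mem_union, Finset.mem_filter]
    constructor
    · rintro ⟨h | h, h'⟩
      · have := hT _ _ h; omega
      · exact h
    · intro h
      have := hU _ _ h
      exact ⟨Or.inr h, by omega⟩

theorem Fd.un {a b x : ℕ} {T : Finset (ℕ × ℕ)} (hT : Fd a b T) (h1 : a ≤ x) (h2 : x ≤ b) :
    Un T x ↔ x = a ∨ x = b := by
  constructor
  · intro h
    by_contra hne
    exact h a b (hT.2.2 (by omega)) (by omega) (by omega)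
  · intro h
    exact un_out hT.1.1 (by omega)

theorem Gd.toFd {a b : ℕ} {T : Finset (ℕ × ℕ)} (hT : Gd a b T) (hab : a < b)
    (hu : ∀ x, a ≤ x → x ≤ b → Un T x → x = a ∨ x = b) : Fd a b T := by
  refine ⟨hT, hab, fun h2 => ?_⟩
  by_contra hr
  refine hr (consec (i := a) (j := b) hT.2.1 (left_mem (by omega)) (right_mem (by omega)) h2 ?_).1
  intro z hz h3 h4
  have h5 := mem_ccell.1 hz
  have := hu z h5.1.1 h5.1.2 ?_
  · omega
  · intro k l hk h6 h7
    have := hT.1 k l hk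
    exact h5.2 ⟨k, l, hk, this.1, this.2.2, fun e => hr (e ▸ hk), h6, h7⟩

inductive Tr : Type
  | leaf : Tr
  | tri : Tr → Tr → Tr
  | quad : Tr → Tr → Tr → Tr

def Tr.sz : Tr → ℕ
  | .leaf => 1
  | .tri s t => s.sz + t.sz
  | .quad s t u => s.sz + t.sz + u.sz

def Tr.nc : Tr → ℕ
  | .leaf => 0
  | .tri s t => s.nc + t.nc + 1
  | .quad s t u => s.nc + t.nc + u.nc + 1

def Tr.enc : Tr → ℕ → Finset (ℕ × ℕ)
  | .leaf, _ => ∅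
  | .tri s t, a => insert (a, a + (s.sz + t.sz)) (s.enc a ∪ t.enc (a + s.sz))
  | .quad s t u, a => insert (a, a + (s.sz + t.sz + u.sz))
      (s.enc a ∪ (t.enc (a + s.sz) ∪ u.enc (a + s.sz + t.sz)))

theorem Tr.sz_pos (t : Tr) : 0 < t.sz := by
  induction t <;> simp only [Tr.sz] <;> omega

theorem root_notin {a x b : ℕ} {T U : Finset (ℕ × ℕ)} (hT : Bd a x T) (hU : Bd x b U)
    (h1 : a < x) (h2 : x < b) : (a, b) ∉ T ∪ U := by
  intro h
  rcases Finset.mem_union.1 h with h | h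
  · have := hT _ _ h; omega
  · have := hU _ _ h; omega

theorem disj {a x b : ℕ} {T U : Finset (ℕ × ℕ)} (hT : Bd a x T) (hU : Bd x b U) :
    Disjoint T U := by
  rw [Finset.disjoint_left]
  rintro ⟨k, l⟩ h1 h2
  have := hT _ _ h1; have := hU _ _ h2; omega

theorem tri_un {a x b : ℕ} {T U : Finset (ℕ × ℕ)} (hT : Fd a x T) (hU : Fd x b U) (z : ℕ) :
    (a ≤ z ∧ z ≤ b) ∧ Un (T ∪ U) z ↔ z = a ∨ z = x ∨ z = b := by
  rw [un_union]
  have := hT.2.1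
  have := hU.2.1
  constructor
  · rintro ⟨⟨h1, h2⟩, h3, h4⟩
    rcases Nat.lt_or_ge x z with h | h
    · have := (hU.un (by omega) h2).1 h4; omega
    · have := (hT.un h1 (by omega)).1 h3; omega
  · intro h
    refine ⟨by omega, un_out hT.1.1 (by omega), un_out hU.1.1 (by omega)⟩

theorem quad_un {a x y b : ℕ} {T U V : Finset (ℕ × ℕ)} (hT : Fd a x T) (hU : Fd x y U)
    (hV : Fd y b V) (z : ℕ) :
    (a ≤ z ∧ z ≤ b) ∧ Un (T ∪ (U ∪ V)) z ↔ z = a ∨ z = x ∨ z = y ∨ z = b := by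
  rw [un_union]
  have := hT.2.1
  have := hU.2.1
  have := hV.2.1
  constructor
  · rintro ⟨⟨h1, h2⟩, h3, h4⟩
    rcases Nat.lt_or_ge x z with h | h
    · have := (tri_un hU hV z).1 ⟨⟨by omega, h2⟩, h4⟩; omega
    · have := (hT.un h1 (by omega)).1 h3; omega
  · intro h
    refine ⟨by omega, un_out hT.1.1 (by omega), ?_⟩
    rw [un_union]
    exact ⟨un_out hU.1.1 (by omega), un_out hV.1.1 (by omega)⟩

theorem tri_cell {a x b : ℕ} {T U : Finset (ℕ × ℕ)} (hT : Fd a x T) (hU : Fd x b U) :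
    ccell (insert (a, b) (T ∪ U)) a b = {a, x, b} := by
  ext z
  rw [mem_root (glue hT.2.1.le hU.2.1.le hT.1 hU.1).1
    (root_notin hT.1.1 hU.1.1 hT.2.1 hU.2.1) rfl, tri_un hT hU]
  simp

theorem quad_cell {a x y b : ℕ} {T U V : Finset (ℕ × ℕ)} (hT : Fd a x T) (hU : Fd x y U)
    (hV : Fd y b V) :
    ccell (insert (a, b) (T ∪ (U ∪ V))) a b = {a, x, y, b} := by
  have h1 := hT.2.1
  have h2 := hU.2.1
  have h3 := hV.2.1
  have hUV := glue h2.le h3.le hU.1 hV.1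
  ext z
  rw [mem_root (glue h1.le (by omega) hT.1 hUV).1
    (root_notin hT.1.1 hUV.1 h1 (by omega)) rfl, quad_un hT hU hV]
  simp

theorem card3 {a x b : ℕ} (h1 : a < x) (h2 : x < b) : ({a, x, b} : Finset ℕ).card = 3 :=
  Finset.card_eq_three.2 ⟨a, x, b, by omega, by omega, by omega, rfl⟩

theorem card4 {a x y b : ℕ} (h1 : a < x) (h2 : x < y) (h3 : y < b) :
    ({a, x, y, b} : Finset ℕ).card = 4 := by
  rw [Finset.card_insert_of_notMem, card3 h2 h3]
  simp; omega

theorem Fd.tri {a x b : ℕ} {T U : Finset (ℕ × ℕ)} (hT : Fd a x T) (hU : Fd x b U) :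
    Fd a b (insert (a, b) (T ∪ U)) := by
  have h1 := hT.2.1
  have h2 := hU.2.1
  refine add_root (glue h1.le h2.le hT.1 hU.1) (root_notin hT.1.1 hU.1.1 h1 h2) (by omega)
    (Or.inl ?_)
  rw [tri_cell hT hU, card3 h1 h2]

theorem Fd.quad {a x y b : ℕ} {T U V : Finset (ℕ × ℕ)} (hT : Fd a x T) (hU : Fd x y U)
    (hV : Fd y b V) : Fd a b (insert (a, b) (T ∪ (U ∪ V))) := by
  have h1 := hT.2.1
  have h2 := hU.2.1
  have h3 := hV.2.1
  have hUV := glue h2.le h3.le hU.1 hV.1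
  refine add_root (glue h1.le (by omega) hT.1 hUV) (root_notin hT.1.1 hUV.1 h1 (by omega))
    (by omega) (Or.inr ?_)
  rw [quad_cell hT hU hV, card4 h1 h2 h3]

theorem Tr.enc_Fd (t : Tr) : ∀ a, Fd a (a + t.sz) (t.enc a) := by
  induction t with
  | leaf =>
    intro a
    refine ⟨⟨?_, ?_, ?_⟩, by simp [Tr.sz], by simp [Tr.sz]⟩ <;> simp [Tr.enc, Bd, NC]
  | tri s t hs ht =>
    intro a
    have h1 := hs a
    have h2 := ht (a + s.sz)
    rw [add_assoc] at h2
    exact h1.tri h2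
  | quad s t u hs ht hu =>
    intro a
    have h1 := hs a
    have h2 := ht (a + s.sz)
    have h3 := hu (a + s.sz + t.sz)
    have e : a + s.sz + t.sz + u.sz = a + (s.sz + t.sz + u.sz) := by omega
    rw [e] at h3
    exact h1.quad h2 h3

theorem Tr.enc_card (t : Tr) : ∀ a, (t.enc a).card = t.nc := by
  induction t with
  | leaf => intro a; simp [Tr.enc, Tr.nc]
  | tri s t hs ht =>
    intro a
    have h1 := s.enc_Fd a
    have h2 := t.enc_Fd (a + s.sz)
    rw [add_assoc] at h2
    simp only [Tr.enc, Tr.nc]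
    rw [Finset.card_insert_of_notMem (root_notin h1.1.1 h2.1.1 h1.2.1 h2.2.1),
      Finset.card_union_of_disjoint (disj h1.1.1 h2.1.1), hs, ht]
  | quad s t u hs ht hu =>
    intro a
    have h1 := s.enc_Fd a
    have h2 := t.enc_Fd (a + s.sz)
    have h3 := u.enc_Fd (a + s.sz + t.sz)
    have e : a + s.sz + t.sz + u.sz = a + (s.sz + t.sz + u.sz) := by omega
    rw [e] at h3
    have hUV := glue h2.2.1.le h3.2.1.le h2.1 h3.1
    simp only [Tr.enc, Tr.nc]
    rw [Finset.card_insert_of_notMem (root_notin h1.1.1 hUV.1 h1.2.1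
        (lt_trans h2.2.1 h3.2.1)),
      Finset.card_union_of_disjoint (disj h1.1.1 hUV.1),
      Finset.card_union_of_disjoint (disj h2.1.1 h3.1.1), hs, ht, hu]
    omega

theorem surj_aux (L : ℕ) : ∀ a T, Fd a (a + L) T → ∃ t : Tr, t.sz = L ∧ t.enc a = T := by
  induction L using Nat.strong_induction_on with
  | _ L ih =>
  intro a T hT
  have hL := hT.2.1
  rcases Nat.lt_or_ge L 2 with h | h
  · refine ⟨.leaf, by simp only [Tr.sz]; omega, ?_⟩
    symm
    simp only [Tr.enc]
    rw [Finset.eq_empty_iff_forall_notMem]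
    rintro ⟨i, j⟩ hij
    have := hT.1.1 i j hij
    omega
  · have ih' : ∀ u v T, a ≤ u → v ≤ a + L → v - u < L → Fd u v T →
        ∃ t : Tr, u + t.sz = v ∧ t.enc u = T := by
      intro u v T h1 h2 h3 h4
      have := h4.2.1
      obtain ⟨t, e1, e2⟩ := ih (v - u) h3 u T (by rwa [show u + (v - u) = v by omega])
      exact ⟨t, by omega, e2⟩
    obtain ⟨hU, hr, hTU, hc⟩ := del_root hT (by omega)
    set U := T.erase (a, a + L)
    have hmem := mem_root hU.1 hr hTU
    have ha := left_mem (T := T) hL.le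
    have hb := right_mem (T := T) hL.le
    set b := a + L with hbL
    have hone : ∀ x, a < x → x < b → x ∈ ccell T a b → ∃ T1 V, U = T1 ∪ V ∧ Gd a x T1 ∧
        Gd x b V ∧ (∀ z, a ≤ z → z ≤ x → Un T1 z → z ∈ ccell T a b) ∧
        (∀ z, x ≤ z → z ≤ b → Un V z → z ∈ ccell T a b) ∧
        (∀ z, x ≤ z → z ≤ b → z ∈ ccell T a b → Un V z) := by
      intro x hax hxb hx
      obtain ⟨h1, h2, h3⟩ := split hU ((hmem x).1 hx).2
      refine ⟨_, _, h3, h1, h2, ?_, ?_, ?_⟩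
      · intro z hz1 hz2 hz
        rw [hmem, h3, un_union]
        exact ⟨⟨by omega, by omega⟩, hz, un_out h2.1 (by omega)⟩
      · intro z hz1 hz2 hz
        rw [hmem, h3, un_union]
        exact ⟨⟨by omega, by omega⟩, un_out h1.1 (by omega), hz⟩
      · intro z hz1 hz2 hz
        rw [hmem, h3, un_union] at hz
        exact hz.2.2
    rcases hc with hc | hc
    · have : ∃ x, a < x ∧ x < b ∧ ccell T a b = {a, x, b} := by
        have h1 : (((ccell T a b).erase a).erase b).card = 1 := by
          rw [Finset.card_erase_of_mem, Finset.card_erase_of_mem ha, hc]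
          exact Finset.mem_erase.2 ⟨by omega, hb⟩
        obtain ⟨x, hx⟩ := Finset.card_eq_one.1 h1
        have hx' : x ∈ ((ccell T a b).erase a).erase b := by simp [hx]
        simp only [Finset.mem_erase] at hx'
        have hx2 := (mem_ccell.1 hx'.2.2).1
        refine ⟨x, by omega, by omega, ?_⟩
        rw [← Finset.insert_erase ha, ← Finset.insert_erase
          (Finset.mem_erase.2 ⟨by omega, hb⟩ : b ∈ (ccell T a b).erase a), hx]
        congr 1
        exact Finset.pair_comm _ _
      obtain ⟨x, hax, hxb, hcell⟩ := this
      obtain ⟨T1, V, e1, g1, g2, u1, u2, -⟩ := hone x hax hxb (by simp [hcell])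
      have f1 : Fd a x T1 := g1.toFd hax (fun z h1 h2 h3 => by
        have := u1 z h1 h2 h3
        simp [hcell] at this; omega)
      have f2 : Fd x b V := g2.toFd hxb (fun z h1 h2 h3 => by
        have := u2 z h1 h2 h3
        simp [hcell] at this; omega)
      obtain ⟨s, hs1, hs2⟩ := ih' a x T1 le_rfl (by omega) (by omega) f1
      obtain ⟨t, ht1, ht2⟩ := ih' x b V (by omega) (by omega) (by omega) f2
      refine ⟨.tri s t, by simp only [Tr.sz]; omega, ?_⟩
      simp only [Tr.enc]
      rw [show a + (s.sz + t.sz) = b by omega, hs1, hs2, ht2, hTU, e1]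
    · have : ∃ x y, a < x ∧ x < y ∧ y < b ∧ ccell T a b = {a, x, y, b} := by
        have h1 : (((ccell T a b).erase a).erase b).card = 2 := by
          rw [Finset.card_erase_of_mem, Finset.card_erase_of_mem ha, hc]
          exact Finset.mem_erase.2 ⟨by omega, hb⟩
        obtain ⟨x, y, hxy, hx⟩ : ∃ x y, x < y ∧ ((ccell T a b).erase a).erase b = {x, y} := by
          obtain ⟨x, y, hxy, hx⟩ := Finset.card_eq_two.1 h1
          rcases Nat.lt_or_gt_of_ne hxy with h | h
          · exact ⟨x, y, h, hx⟩
          · exact ⟨y, x, h, by rw [hx, Finset.pair_comm]⟩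
        have hx' : x ∈ ((ccell T a b).erase a).erase b := by simp [hx]
        have hy' : y ∈ ((ccell T a b).erase a).erase b := by simp [hx]
        simp only [Finset.mem_erase] at hx' hy'
        have hx2 := (mem_ccell.1 hx'.2.2).1
        have hy2 := (mem_ccell.1 hy'.2.2).1
        refine ⟨x, y, by omega, hxy, by omega, ?_⟩
        rw [← Finset.insert_erase ha, ← Finset.insert_erase
          (Finset.mem_erase.2 ⟨by omega, hb⟩ : b ∈ (ccell T a b).erase a), hx]
        ext z
        simp only [Finset.mem_insert, Finset.mem_singleton]
        tauto
      obtain ⟨x, y, hax, hxy, hyb, hcell⟩ := this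
      obtain ⟨T1, V, e1, g1, g2, u1, u2, u3⟩ := hone x hax (by omega) (by simp [hcell])
      obtain ⟨k1, k2, k3⟩ := split g2 (u3 y (by omega) (by omega) (by simp [hcell]))
      have f1 : Fd a x T1 := g1.toFd hax (fun z h1 h2 h3 => by
        have := u1 z h1 h2 h3
        simp [hcell] at this; omega)
      have f2 := k1.toFd hxy (fun z h1 h2 h3 => by
        have := u2 z h1 (by omega) (by
          rw [k3, un_union]; exact ⟨h3, un_out k2.1 (by omega)⟩)
        simp [hcell] at this; omega)
      have f3 := k2.toFd hyb (fun z h1 h2 h3 => by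
        have := u2 z (by omega) (by omega) (by
          rw [k3, un_union]; exact ⟨un_out k1.1 (by omega), h3⟩)
        simp [hcell] at this; omega)
      obtain ⟨s, hs1, hs2⟩ := ih' a x T1 le_rfl (by omega) (by omega) f1
      obtain ⟨t, ht1, ht2⟩ := ih' x y _ (by omega) (by omega) (by omega) f2
      obtain ⟨u, hu1, hu2⟩ := ih' y b _ (by omega) (by omega) (by omega) f3
      refine ⟨.quad s t u, by simp only [Tr.sz]; omega, ?_⟩
      simp only [Tr.enc]
      rw [show a + (s.sz + t.sz + u.sz) = b by omega, hs1, ht1, hs2, ht2, hu2, ← k3, hTU, e1]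

theorem insert_cancel {r : ℕ × ℕ} {U V : Finset (ℕ × ℕ)} (hU : r ∉ U) (hV : r ∉ V)
    (h : insert r U = insert r V) : U = V := by
  rw [← Finset.erase_insert hU, h, Finset.erase_insert hV]

theorem tri_cancel {a b x x' : ℕ} {T U T' U' : Finset (ℕ × ℕ)} (hT : Fd a x T) (hU : Fd x b U)
    (hT' : Fd a x' T') (hU' : Fd x' b U')
    (h : insert (a, b) (T ∪ U) = insert (a, b) (T' ∪ U')) : x = x' ∧ T = T' ∧ U = U' := by
  have hx : x = x' := by
    have e := tri_cell hT hU
    rw [h, tri_cell hT' hU'] at e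
    have : x ∈ ({a, x', b} : Finset ℕ) := by rw [e]; simp
    have h1 := hT.2.1
    have h2 := hU.2.1
    simp at this; omega
  subst hx
  have e := insert_cancel (root_notin hT.1.1 hU.1.1 hT.2.1 hU.2.1)
    (root_notin hT'.1.1 hU'.1.1 hT'.2.1 hU'.2.1) h
  have f1 := filter_glue hT.1.1 hU.1.1
  have f2 := filter_glue hT'.1.1 hU'.1.1
  rw [← e] at f2
  exact ⟨rfl, f1.1.symm.trans f2.1, f1.2.symm.trans f2.2⟩

theorem quad_cancel {a b x x' y y' : ℕ} {T U V T' U' V' : Finset (ℕ × ℕ)}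
    (hT : Fd a x T) (hU : Fd x y U) (hV : Fd y b V)
    (hT' : Fd a x' T') (hU' : Fd x' y' U') (hV' : Fd y' b V')
    (h : insert (a, b) (T ∪ (U ∪ V)) = insert (a, b) (T' ∪ (U' ∪ V'))) :
    x = x' ∧ y = y' ∧ T = T' ∧ U = U' ∧ V = V' := by
  have h1 := hT.2.1
  have h2 := hU.2.1
  have h3 := hV.2.1
  have h1' := hT'.2.1
  have h2' := hU'.2.1
  have h3' := hV'.2.1
  have hx : x = x' ∧ y = y' := by
    have e := quad_cell hT hU hV
    rw [h, quad_cell hT' hU' hV'] at e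
    have k1 : x ∈ ({a, x', y', b} : Finset ℕ) := by rw [e]; simp
    have k2 : y ∈ ({a, x', y', b} : Finset ℕ) := by rw [e]; simp
    simp at k1 k2; omega
  obtain ⟨rfl, rfl⟩ := hx
  have g := glue h2.le h3.le hU.1 hV.1
  have g' := glue h2'.le h3'.le hU'.1 hV'.1
  have e := insert_cancel (root_notin hT.1.1 g.1 h1 (by omega))
    (root_notin hT'.1.1 g'.1 h1' (by omega)) h
  have f1 := filter_glue hT.1.1 g.1
  have f2 := filter_glue hT'.1.1 g'.1
  rw [← e] at f2
  have e2 := f1.2.symm.trans f2.2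
  have k1 := filter_glue hU.1.1 hV.1.1
  have k2 := filter_glue hU'.1.1 hV'.1.1
  rw [← e2] at k2
  exact ⟨rfl, rfl, f1.1.symm.trans f2.1, k1.1.symm.trans k2.1, k1.2.symm.trans k2.2⟩

theorem enc_tri_Fd (s t : Tr) (a : ℕ) :
    Fd a (a + s.sz) (s.enc a) ∧ Fd (a + s.sz) (a + (s.sz + t.sz)) (t.enc (a + s.sz)) := by
  have h2 := t.enc_Fd (a + s.sz)
  rw [add_assoc] at h2
  exact ⟨s.enc_Fd a, h2⟩

theorem enc_quad_Fd (s t u : Tr) (a : ℕ) :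
    Fd a (a + s.sz) (s.enc a) ∧ Fd (a + s.sz) (a + s.sz + t.sz) (t.enc (a + s.sz)) ∧
    Fd (a + s.sz + t.sz) (a + (s.sz + t.sz + u.sz)) (u.enc (a + s.sz + t.sz)) := by
  have h3 := u.enc_Fd (a + s.sz + t.sz)
  have e : a + s.sz + t.sz + u.sz = a + (s.sz + t.sz + u.sz) := by omega
  rw [e] at h3
  exact ⟨s.enc_Fd a, t.enc_Fd _, h3⟩

theorem tri_ne_quad (s t s' t' u' : Tr) (a : ℕ) (hsz : (Tr.tri s t).sz = (Tr.quad s' t' u').sz)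
    (h : (Tr.tri s t).enc a = (Tr.quad s' t' u').enc a) : False := by
  obtain ⟨h1, h2⟩ := enc_tri_Fd s t a
  obtain ⟨k1, k2, k3⟩ := enc_quad_Fd s' t' u' a
  simp only [Tr.sz] at hsz
  simp only [Tr.enc] at h
  rw [← hsz] at k3 h
  have e := tri_cell h1 h2
  rw [h, quad_cell k1 k2 k3] at e
  have c := congrArg Finset.card e
  rw [card4 k1.2.1 k2.2.1 k3.2.1, card3 h1.2.1 h2.2.1] at c
  omega

theorem enc_inj (t : Tr) : ∀ (t' : Tr) (a : ℕ), t.sz = t'.sz → t.enc a = t'.enc a → t = t' := by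
  induction t with
  | leaf =>
    intro t' a h1 h2
    cases t' with
    | leaf => rfl
    | tri s t => have := s.sz_pos; have := t.sz_pos; simp only [Tr.sz] at h1; omega
    | quad s t u => have := s.sz_pos; have := t.sz_pos; simp only [Tr.sz] at h1; omega
  | tri s t hs ht =>
    intro t' a h1 h2
    cases t' with
    | leaf => have := s.sz_pos; have := t.sz_pos; simp only [Tr.sz] at h1; omega
    | tri s' t' =>
      obtain ⟨f1, f2⟩ := enc_tri_Fd s t a
      obtain ⟨k1, k2⟩ := enc_tri_Fd s' t' a
      simp only [Tr.sz] at h1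
      simp only [Tr.enc] at h2
      rw [← h1] at k2 h2
      obtain ⟨e1, e2, e3⟩ := tri_cancel f1 f2 k1 k2 h2
      have hs1 : s.sz = s'.sz := by omega
      rw [← hs1] at e3
      rw [hs s' a hs1 e2, ht t' _ (by omega) e3]
    | quad s' t' u' => exact (tri_ne_quad _ _ _ _ _ _ h1 h2).elim
  | quad s t u hs ht hu =>
    intro t' a h1 h2
    cases t' with
    | leaf => have := s.sz_pos; have := t.sz_pos; simp only [Tr.sz] at h1; omega
    | tri s' t' => exact (tri_ne_quad _ _ _ _ _ _ h1.symm h2.symm).elim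
    | quad s' t' u' =>
      obtain ⟨f1, f2, f3⟩ := enc_quad_Fd s t u a
      obtain ⟨k1, k2, k3⟩ := enc_quad_Fd s' t' u' a
      simp only [Tr.sz] at h1
      simp only [Tr.enc] at h2
      rw [← h1] at k3 h2
      obtain ⟨e1, e2, e3, e4, e5⟩ := quad_cancel f1 f2 f3 k1 k2 k3 h2
      have hs1 : s.sz = s'.sz := by omega
      have hs2 : t.sz = t'.sz := by omega
      rw [← hs1] at e4
      rw [← hs1, ← hs2] at e5
      rw [hs s' a hs1 e3, ht t' _ hs2 e4, hu u' _ (by omega) e5]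

theorem tree_ncard (n m : ℕ) :
    {T : Finset (ℕ × ℕ) | Fd 0 (n + 1) T ∧ T.card = m}.ncard =
      {t : Tr | t.sz = n + 1 ∧ t.nc = m}.ncard := by
  rw [← Set.InjOn.ncard_image (f := fun t : Tr => t.enc 0)]
  · congr 1
    ext T
    simp only [Set.mem_ofPred_eq, Set.mem_image]
    constructor
    · rintro ⟨h1, h2⟩
      obtain ⟨t, e1, e2⟩ := surj_aux (n + 1) 0 T (by simpa using h1)
      exact ⟨t, ⟨e1, by rw [← t.enc_card 0, e2, h2]⟩, e2⟩
    · rintro ⟨t, ⟨e1, e2⟩, rfl⟩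
      refine ⟨?_, by rw [t.enc_card, e2]⟩
      have := t.enc_Fd 0
      rwa [e1, zero_add] at this
  · rintro t ⟨h1, _⟩ t' ⟨h2, _⟩ h
    exact enc_inj t t' 0 (by rw [h1, h2]) h

theorem tree_finite (n m : ℕ) : {t : Tr | t.sz = n + 1 ∧ t.nc = m}.Finite := by
  apply Set.Finite.of_finite_image (f := fun t : Tr => t.enc 0)
  · apply Set.Finite.subset
      ((Finset.range (n + 2) ×ˢ Finset.range (n + 2)).powerset.finite_toSet)
    rintro T ⟨t, ⟨h1, _⟩, rfl⟩
    simp only [Finset.coe_powerset, Set.mem_preimage, Set.mem_powerset_iff, Finset.coe_subset]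
    rintro ⟨i, j⟩ hij
    have := (t.enc_Fd 0).1.1 i j hij
    simp only [Finset.mem_product, Finset.mem_range]
    omega
  · rintro t ⟨h1, _⟩ t' ⟨h2, _⟩ h
    exact enc_inj t t' 0 (by rw [h1, h2]) h

theorem pair_eq_iff {N : ℕ} {x y u v : Fin N} (h1 : x < y) (h2 : u < v) :
    ({x, y} : Finset (Fin N)) = {u, v} ↔ x = u ∧ y = v := by
  constructor
  · intro h
    have k1 : x ∈ ({u, v} : Finset (Fin N)) := by rw [← h]; simp
    have k2 : y ∈ ({u, v} : Finset (Fin N)) := by rw [← h]; simp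
    simp only [Finset.mem_insert, Finset.mem_singleton] at k1 k2
    omega
  · rintro ⟨rfl, rfl⟩; rfl

theorem exists_pair {N : ℕ} {e : Finset (Fin N)} (h : e.card = 2) :
    ∃ x y, x < y ∧ e = {x, y} := by
  obtain ⟨x, y, hxy, rfl⟩ := Finset.card_eq_two.1 h
  rcases lt_or_gt_of_ne hxy with h | h
  · exact ⟨x, y, h, rfl⟩
  · exact ⟨y, x, h, Finset.pair_comm _ _⟩

theorem side_iff {n : ℕ} {x y : Fin (n + 2)} (h : x < y) :
    IsSide (n + 2) {x, y} ↔ y.val = x.val + 1 ∨ (x.val = 0 ∧ y.val = n + 1) := by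
  have hx := x.2
  have hy := y.2
  have hxy : x.val < y.val := h
  constructor
  · rintro ⟨i, hi, he⟩
    have hi2 := i.2
    by_cases hlt : i.val + 1 < n + 2
    · have hc : (cyc i).val = i.val + 1 := by simp [cyc, Nat.mod_eq_of_lt hlt]
      rw [pair_eq_iff h (by rw [Fin.lt_def]; omega)] at he
      rw [he.1, he.2]; omega
    · have hc : (cyc i).val = 0 := by
        simp only [cyc]
        rw [show i.val + 1 = n + 2 by omega, Nat.mod_self]
      rw [Finset.pair_comm i, pair_eq_iff h (by rw [Fin.lt_def]; omega)] at he
      rw [he.1, he.2]; omega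
  · rintro (h1 | ⟨h1, h2⟩)
    · have hc : cyc x = y := by
        ext
        simp only [cyc]
        rw [Nat.mod_eq_of_lt (by omega)]; omega
      exact ⟨x, by rw [hc]; exact h.ne, by rw [hc]⟩
    · have hc : cyc y = x := by
        ext
        simp only [cyc]
        rw [h2, Nat.mod_self]; omega
      exact ⟨y, by rw [hc]; exact h.ne', by rw [hc, Finset.pair_comm]⟩

theorem crosses_iff {N : ℕ} {x y u v : Fin N} (h1 : x < y) (h2 : u < v) :
    Crosses N {x, y} {u, v} ↔ (x < u ∧ u < y ∧ y < v) ∨ (u < x ∧ x < v ∧ v < y) := by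
  constructor
  · rintro ⟨a, b, c, d, e1, e2, e3, ⟨e4, e5⟩ | ⟨e4, e5⟩⟩
    · rw [pair_eq_iff h1 (by omega)] at e4
      rw [pair_eq_iff h2 (by omega)] at e5
      omega
    · rw [pair_eq_iff h1 (by omega)] at e4
      rw [pair_eq_iff h2 (by omega)] at e5
      omega
  · rintro (⟨e1, e2, e3⟩ | ⟨e1, e2, e3⟩)
    · exact ⟨x, y, u, v, e1, e2, e3, Or.inl ⟨rfl, rfl⟩⟩
    · exact ⟨u, v, x, y, e1, e2, e3, Or.inr ⟨rfl, rfl⟩⟩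

theorem isNext_iff {N : ℕ} {c : Finset (Fin N)} {x y : Fin N} :
    IsNext c x y ↔ x ∈ c ∧ y ∈ c ∧ ((x < y ∧ ∀ z ∈ c, x < z → z < y → False) ∨
      (y < x ∧ ∀ z ∈ c, y ≤ z ∧ z ≤ x)) := by
  have sub : ∀ p q : Fin N, (q.val ≤ p.val ∧ (p - q).val + q.val = p.val) ∨
      (p.val < q.val ∧ (p - q).val + q.val = N + p.val) := by
    intro p q
    have hp := p.2
    have hq := q.2
    rcases Nat.lt_or_ge p.val q.val with h | h
    · right
      refine ⟨h, ?_⟩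
      rw [Fin.val_sub, Nat.mod_eq_of_lt (by omega)]; omega
    · left
      refine ⟨h, ?_⟩
      rw [Fin.val_sub, show N - q.val + p.val = (p.val - q.val) + N by omega, Nat.add_mod_right,
        Nat.mod_eq_of_lt (by omega)]; omega
  have hyx := sub y x
  have hy := y.2
  have hx := x.2
  unfold IsNext
  refine and_congr_right fun hxc => and_congr_right fun hyc => ?_
  simp only [Fin.lt_def, Fin.le_def, ne_eq, Fin.ext_iff]
  constructor
  · rintro ⟨h1, h2⟩
    rcases Nat.lt_or_gt_of_ne h1 with h | h
    · right
      refine ⟨h, fun z hz => ?_⟩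
      by_cases hzx : z.val = x.val
      · omega
      · have := h2 z hz hzx
        have := sub z x
        have := z.2
        omega
    · left
      refine ⟨h, fun z hz h3 h4 => ?_⟩
      have := h2 z hz (by omega)
      have := sub z x
      omega
  · rintro (⟨h1, h2⟩ | ⟨h1, h2⟩)
    · refine ⟨by omega, fun z hz hzx => ?_⟩
      have : ¬ (x.val < z.val ∧ z.val < y.val) := fun h => h2 z hz h.1 h.2
      have := sub z x
      have := z.2
      omega
    · refine ⟨by omega, fun z hz hzx => ?_⟩
      have := h2 z hz
      have := sub z x
      have := z.2
      omega

open Classical in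
/-- The set of chords of `S`, together with the root. -/
noncomputable def TT (n : ℕ) (S : Finset (Finset (Fin (n + 2)))) : Finset (ℕ × ℕ) :=
  ((Finset.univ : Finset (Fin (n + 2) × Fin (n + 2))).filter (fun p => p.1.val + 2 ≤ p.2.val ∧
    ({p.1, p.2} ∈ S ∨ (p.1.val = 0 ∧ p.2.val = n + 1)))).image (fun p => (p.1.val, p.2.val))

theorem mem_TT {n : ℕ} {S : Finset (Finset (Fin (n + 2)))} {i j : ℕ} :
    (i, j) ∈ TT n S ↔ ∃ x y : Fin (n + 2), x.val = i ∧ y.val = j ∧ i + 2 ≤ j ∧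
      ({x, y} ∈ S ∨ (i = 0 ∧ j = n + 1)) := by
  classical
  simp only [TT, Finset.mem_image, Finset.mem_filter, Finset.mem_univ, true_and, Prod.exists,
    Prod.mk.injEq]
  constructor
  · rintro ⟨x, y, h, rfl, rfl⟩
    exact ⟨x, y, rfl, rfl, h⟩
  · rintro ⟨x, y, rfl, rfl, h⟩
    exact ⟨x, y, h, rfl, rfl⟩

theorem mem_TT' {n : ℕ} {S : Finset (Finset (Fin (n + 2)))} {x y : Fin (n + 2)} :
    (x.val, y.val) ∈ TT n S ↔ x.val + 2 ≤ y.val ∧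
      ({x, y} ∈ S ∨ (x.val = 0 ∧ y.val = n + 1)) := by
  rw [mem_TT]
  constructor
  · rintro ⟨x', y', h1, h2, h3⟩
    obtain rfl := Fin.ext h1
    obtain rfl := Fin.ext h2
    exact h3
  · intro h
    exact ⟨x, y, rfl, rfl, h⟩

theorem TT_Bd (n : ℕ) (S : Finset (Finset (Fin (n + 2)))) : Bd 0 (n + 1) (TT n S) := by
  intro i j h
  obtain ⟨x, y, rfl, rfl, h, -⟩ := mem_TT.1 h
  have := y.2
  omega

theorem TT_root (n : ℕ) (S : Finset (Finset (Fin (n + 2)))) (h : 0 + 2 ≤ n + 1) :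
    (0, n + 1) ∈ TT n S :=
  mem_TT.2 ⟨0, Fin.last _, rfl, rfl, h, Or.inr ⟨rfl, rfl⟩⟩

def Dg (n : ℕ) (e : Finset (Fin (n + 2))) : Prop :=
  ∃ x y : Fin (n + 2), e = {x, y} ∧ x.val + 2 ≤ y.val ∧ ¬ (x.val = 0 ∧ y.val = n + 1)

theorem isDiag_iff {n : ℕ} {e : Finset (Fin (n + 2))} : IsDiag (n + 2) e ↔ Dg n e := by
  constructor
  · rintro ⟨h1, h2⟩
    obtain ⟨x, y, hxy, rfl⟩ := exists_pair h1
    rw [side_iff hxy] at h2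
    rw [Fin.lt_def] at hxy
    exact ⟨x, y, rfl, by omega, by omega⟩
  · rintro ⟨x, y, rfl, h1, h2⟩
    have hxy : x < y := by rw [Fin.lt_def]; omega
    refine ⟨Finset.card_pair hxy.ne, ?_⟩
    rw [side_iff hxy]
    omega

theorem isDissection_iff {n : ℕ} {S : Finset (Finset (Fin (n + 2)))} :
    IsDissection (n + 2) S ↔ (∀ e ∈ S, Dg n e) ∧ NC (TT n S) := by
  unfold IsDissection
  simp only [isDiag_iff]
  refine and_congr_right fun hD => ?_
  constructor
  · intro h a b c d h1 h2 h3 h4 h5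
    obtain ⟨x, y, rfl, rfl, k1, k2⟩ := mem_TT.1 h1
    obtain ⟨u, v, rfl, rfl, k3, k4⟩ := mem_TT.1 h2
    have := v.2
    have := y.2
    rcases k2 with k2 | k2
    · rcases k4 with k4 | k4
      · refine h _ k2 _ k4 ?_
        rw [crosses_iff (by rw [Fin.lt_def]; omega) (by rw [Fin.lt_def]; omega)]
        left
        exact ⟨h3, h4, h5⟩
      · omega
    · omega
  · intro h e he f hf hc
    obtain ⟨x, y, rfl, h1, h2⟩ := hD e he
    obtain ⟨u, v, rfl, h3, h4⟩ := hD f hf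
    rw [crosses_iff (by rw [Fin.lt_def]; omega) (by rw [Fin.lt_def]; omega)] at hc
    have m1 := mem_TT'.2 ⟨h1, Or.inl he⟩
    have m2 := mem_TT'.2 ⟨h3, Or.inl hf⟩
    rcases hc with ⟨e1, e2, e3⟩ | ⟨e1, e2, e3⟩
    · exact h _ _ _ _ m1 m2 e1 e2 e3
    · exact h _ _ _ _ m2 m1 e1 e2 e3

theorem spread {N : ℕ} {c : Finset (Fin N)} (h3 : 3 ≤ c.card) (p q : Fin N) :
    ∃ z ∈ c, z ≠ p ∧ z ≠ q := by
  by_contra h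
  push Not at h
  have : c ⊆ {p, q} := by
    intro z hz
    have := h z hz
    simp only [Finset.mem_insert, Finset.mem_singleton]
    tauto
  have := Finset.card_le_card this
  have := Finset.card_le_two (a := p) (b := q)
  omega

theorem isCell_iff {n : ℕ} {S : Finset (Finset (Fin (n + 2)))} (hS : IsDissection (n + 2) S)
    (c : Finset (Fin (n + 2))) :
    IsCell (n + 2) S c ↔ Cell' (TT n S) (c.map Fin.valEmbedding) := by
  have hD := (isDissection_iff.1 hS).1
  unfold IsCell Cell'
  rw [Finset.card_map]
  refine and_congr_right fun h3 => ?_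
  have hmem : ∀ x : Fin (n + 2), x.val ∈ c.map Fin.valEmbedding ↔ x ∈ c := by
    intro x
    simp [Fin.val_inj]
  have hmem' : ∀ i, i ∈ c.map Fin.valEmbedding → ∃ x : Fin (n + 2), x.val = i ∧ x ∈ c := by
    intro i hi
    obtain ⟨x, h1, h2⟩ := Finset.mem_map.1 hi
    exact ⟨x, h2, h1⟩
  have key : ∀ x y : Fin (n + 2), x.val < y.val → ¬ (x.val = 0 ∧ y.val = n + 1) →
      ((IsSide (n + 2) {x, y} ∨ {x, y} ∈ S) ↔ (y.val = x.val + 1 ∨ (x.val, y.val) ∈ TT n S)) := by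
    intro x y hxy hr
    rw [side_iff hxy, mem_TT']
    constructor
    · rintro (h | h)
      · omega
      · by_cases h' : y.val = x.val + 1
        · exact Or.inl h'
        · exact Or.inr ⟨by omega, Or.inl h⟩
    · rintro (h | ⟨h, h' | h'⟩)
      · exact Or.inl (Or.inl h)
      · exact Or.inr h'
      · omega
  have key2 : ∀ p q : Fin (n + 2), p.val + 2 ≤ q.val →
      ((IsSide (n + 2) {p, q} ∨ {p, q} ∈ S) ↔ (p.val, q.val) ∈ TT n S) := by
    intro p q hpq
    rw [side_iff (by rw [Fin.lt_def]; omega), mem_TT']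
    constructor
    · rintro (h | h)
      · exact ⟨hpq, Or.inr (by omega)⟩
      · exact ⟨hpq, Or.inl h⟩
    · rintro ⟨_, h | h⟩
      · exact Or.inr h
      · exact Or.inl (Or.inr h)
  constructor
  · rintro ⟨hA, hB⟩
    have hne : c.Nonempty := Finset.card_pos.1 (by omega)
    set p := c.min' hne
    set q := c.max' hne
    have hp : p ∈ c := c.min'_mem hne
    have hq : q ∈ c := c.max'_mem hne
    have hpq : ∀ z ∈ c, p.val ≤ z.val ∧ z.val ≤ q.val := fun z hz =>
      ⟨c.min'_le z hz, c.le_max' z hz⟩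
    have hpq2 : p.val + 2 ≤ q.val := by
      obtain ⟨z, hz, h1, h2⟩ := spread h3 p q
      have := hpq z hz
      rw [ne_eq, Fin.ext_iff] at h1 h2
      omega
    refine ⟨p, q, (hmem p).2 hp, (hmem q).2 hq, ?_, ?_, ?_, ?_⟩
    · intro z hz
      obtain ⟨z, rfl, -⟩ := hmem' z hz
      replace hz := (hmem z).1 hz
      exact hpq z hz
    · rw [← key2 p q hpq2]
      have := hA q p (isNext_iff.2 ⟨hq, hp, Or.inr ⟨by rw [Fin.lt_def]; omega, hpq⟩⟩)
      rwa [Finset.pair_comm] at this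
    · intro u hu v hv huv hz
      obtain ⟨u, rfl, -⟩ := hmem' u hu
      replace hu := (hmem u).1 hu
      obtain ⟨v, rfl, -⟩ := hmem' v hv
      replace hv := (hmem v).1 hv
      have hz' : ∀ z ∈ c, u < z → z < v → False := fun z hzc h1 h2 =>
        hz z.val ((hmem z).2 hzc) h1 h2
      rw [← key u v huv]
      · exact hA u v (isNext_iff.2 ⟨hu, hv, Or.inl ⟨huv, hz'⟩⟩)
      · intro hr
        obtain ⟨z, hzc, h1, h2⟩ := spread h3 u v
        have := z.2
        rw [ne_eq, Fin.ext_iff] at h1 h2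
        exact hz' z hzc (by rw [Fin.lt_def]; omega) (by rw [Fin.lt_def]; omega)
    · intro k l hkl hk hl
      obtain ⟨k, rfl, -⟩ := hmem' k hk
      replace hk := (hmem k).1 hk
      obtain ⟨l, rfl, -⟩ := hmem' l hl
      replace hl := (hmem l).1 hl
      obtain ⟨h1, h2⟩ := mem_TT'.1 hkl
      have hk' := hpq k hk
      have hl' := hpq l hl
      have hq2 := q.2
      rcases h2 with h2 | h2
      · obtain ⟨x, y, e1, e2⟩ := hB _ h2 (by
          intro w hw
          simp only [Finset.mem_insert, Finset.mem_singleton] at hw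
          rcases hw with rfl | rfl <;> assumption)
        have : IsNext c k l ∨ IsNext c l k := by
          have hkl' : k < l := by rw [Fin.lt_def]; omega
          have hxy : x ≠ y := by
            rintro rfl
            have h5 : k ∈ ({x, x} : Finset (Fin (n + 2))) := by rw [← e1]; simp
            have h6 : l ∈ ({x, x} : Finset (Fin (n + 2))) := by rw [← e1]; simp
            simp at h5 h6
            omega
          rcases lt_or_gt_of_ne hxy with h | h
          · obtain ⟨rfl, rfl⟩ := (pair_eq_iff hkl' h).1 e1
            exact e2
          · rw [Finset.pair_comm x y] at e1
            obtain ⟨rfl, rfl⟩ := (pair_eq_iff hkl' h).1 e1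
            exact e2.symm
        rw [isNext_iff, isNext_iff] at this
        rcases this with ⟨_, _, ⟨_, h⟩ | ⟨h, _⟩⟩ | ⟨_, _, ⟨h, _⟩ | ⟨_, h⟩⟩
        · right
          intro z hz h1 h2
          obtain ⟨z, rfl, -⟩ := hmem' z hz
          replace hz := (hmem z).1 hz
          exact h z hz h1 h2
        · rw [Fin.lt_def] at h; omega
        · rw [Fin.lt_def] at h; omega
        · left
          have e3 := h p hp
          have e4 := h q hq
          simp only [Fin.le_def] at e3 e4
          simp only [Prod.mk.injEq]
          omega
      · left
        simp only [Prod.mk.injEq]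
        omega
  · rintro ⟨p, q, hp, hq, hpq, hT, hcon, hch⟩
    obtain ⟨p, rfl, -⟩ := hmem' p hp
    replace hp := (hmem p).1 hp
    obtain ⟨q, rfl, -⟩ := hmem' q hq
    replace hq := (hmem q).1 hq
    have hpq' : ∀ z ∈ c, p.val ≤ z.val ∧ z.val ≤ q.val := fun z hz => hpq z.val ((hmem z).2 hz)
    constructor
    · intro x y hxy
      rw [isNext_iff] at hxy
      obtain ⟨hx, hy, ⟨h1, h2⟩ | ⟨h1, h2⟩⟩ := hxy
      · rw [key x y h1]
        · refine hcon x.val ((hmem x).2 hx) y.val ((hmem y).2 hy) h1 ?_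
          intro z hz h4 h5
          obtain ⟨z, rfl, -⟩ := hmem' z hz
          replace hz := (hmem z).1 hz
          exact h2 z hz h4 h5
        · intro hr
          obtain ⟨z, hzc, h4, h5⟩ := spread h3 x y
          have := z.2
          rw [ne_eq, Fin.ext_iff] at h4 h5
          exact h2 z hzc (by rw [Fin.lt_def]; omega) (by rw [Fin.lt_def]; omega)
      · have e1 := h2 p hp
        have e2 := h2 q hq
        have e3 := hpq' x hx
        have e4 := hpq' y hy
        simp only [Fin.le_def] at e1 e2
        obtain rfl : y = p := by ext; omega
        obtain rfl : x = q := by ext; omega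
        rw [Finset.pair_comm, key2 y x (mem_TT'.1 hT).1]
        exact hT
    · intro e he hec
      obtain ⟨x, y, rfl, h1, h2⟩ := hD e he
      have hx : x ∈ c := hec (by simp)
      have hy : y ∈ c := hec (by simp)
      refine ⟨x, y, rfl, ?_⟩
      rw [isNext_iff, isNext_iff]
      rcases hch x.val y.val (mem_TT'.2 ⟨h1, Or.inl he⟩) ((hmem x).2 hx) ((hmem y).2 hy) with h | h
      · right
        simp only [Prod.mk.injEq] at h
        obtain rfl : x = p := Fin.ext h.1
        obtain rfl : y = q := Fin.ext h.2
        exact ⟨hy, hx, Or.inr ⟨by rw [Fin.lt_def]; omega, hpq'⟩⟩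
      · left
        refine ⟨hx, hy, Or.inl ⟨by rw [Fin.lt_def]; omega, fun z hz h4 h5 => ?_⟩⟩
        exact h z.val ((hmem z).2 hz) h4 h5

theorem isCell_iff2 {n : ℕ} {S : Finset (Finset (Fin (n + 2)))} (hS : IsDissection (n + 2) S)
    (c : Finset (Fin (n + 2))) :
    IsCell (n + 2) S c ↔ ∃ i j, (i, j) ∈ TT n S ∧
      ccell (TT n S) i j = c.map Fin.valEmbedding := by
  rw [isCell_iff hS, cell'_iff (isDissection_iff.1 hS).2 (fun i j h => (TT_Bd n S i j h).2.1)]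

theorem ccell_fin {n : ℕ} {S : Finset (Finset (Fin (n + 2)))} {i j : ℕ} (h : (i, j) ∈ TT n S) :
    ∃ c : Finset (Fin (n + 2)), c.map Fin.valEmbedding = ccell (TT n S) i j := by
  classical
  refine ⟨Finset.univ.filter (fun x => x.val ∈ ccell (TT n S) i j), ?_⟩
  ext z
  simp only [Finset.mem_map, Finset.mem_filter, Finset.mem_univ, true_and, Fin.valEmbedding_apply]
  constructor
  · rintro ⟨x, hx, rfl⟩; exact hx
  · intro hz
    have h1 := (mem_ccell.1 hz).1
    have h2 := TT_Bd n S i j h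
    exact ⟨⟨z, by omega⟩, hz, rfl⟩

theorem numCells_eq {n : ℕ} {S : Finset (Finset (Fin (n + 2)))} (hS : IsDissection (n + 2) S) :
    numCells (n + 2) S = (TT n S).card := by
  classical
  have hb := TT_Bd n S
  have h1 : ((TT n S).image (fun e => ccell (TT n S) e.1 e.2)).card = (TT n S).card := by
    apply Finset.card_image_of_injOn
    rintro ⟨i, j⟩ h ⟨i', j'⟩ h' he
    have k1 := hb i j h
    have k2 := hb i' j' h'
    have := ccell_inj (by omega) (by omega) he
    exact Prod.ext this.1 this.2
  rw [← h1, ← Set.ncard_coe_finset]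
  unfold numCells
  rw [← Set.InjOn.ncard_image (f := fun c : Finset (Fin (n + 2)) => c.map Fin.valEmbedding)
    (Finset.map_injective _).injOn]
  congr 1
  ext c
  simp only [Set.mem_image, Set.mem_ofPred_eq, Finset.coe_image, Finset.mem_coe, Prod.exists]
  constructor
  · rintro ⟨d, hd, rfl⟩
    exact (isCell_iff2 hS d).1 hd
  · rintro ⟨i, j, h, rfl⟩
    obtain ⟨d, hd⟩ := ccell_fin h
    exact ⟨d, (isCell_iff2 hS d).2 ⟨i, j, h, hd.symm⟩, hd⟩

theorem cells_iff {n : ℕ} {S : Finset (Finset (Fin (n + 2)))} (hS : IsDissection (n + 2) S) :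
    (∀ c : Finset (Fin (n + 2)), IsCell (n + 2) S c → c.card = 3 ∨ c.card = 4) ↔
      Fd 0 (n + 1) (TT n S) := by
  constructor
  · intro h
    refine ⟨⟨TT_Bd n S, (isDissection_iff.1 hS).2, ?_⟩, by omega, TT_root n S⟩
    intro i j hij
    obtain ⟨d, hd⟩ := ccell_fin hij
    have := h d ((isCell_iff2 hS d).2 ⟨i, j, hij, hd.symm⟩)
    rwa [← hd, Finset.card_map]
  · intro h c hc
    obtain ⟨i, j, hij, e⟩ := (isCell_iff2 hS c).1 hc
    have := h.1.2.2 i j hij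
    rwa [e, Finset.card_map] at this

theorem TT_inj {n : ℕ} {S S' : Finset (Finset (Fin (n + 2)))} (hS : ∀ e ∈ S, Dg n e)
    (h : TT n S = TT n S') : S ⊆ S' := by
  intro e he
  obtain ⟨x, y, rfl, h1, h2⟩ := hS e he
  have := mem_TT'.2 ⟨h1, Or.inl he⟩
  rw [h, mem_TT'] at this
  exact this.2.resolve_right h2

theorem TT_surj {n : ℕ} {T : Finset (ℕ × ℕ)} (hT : Fd 0 (n + 1) T) :
    ∃ S, (∀ e ∈ S, Dg n e) ∧ TT n S = T := by
  classical
  refine ⟨Finset.univ.filter (fun e => ∃ x y : Fin (n + 2), e = {x, y} ∧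
    (x.val, y.val) ∈ T ∧ ¬ (x.val = 0 ∧ y.val = n + 1)), ?_, ?_⟩
  · intro e he
    obtain ⟨x, y, h1, h2, h3⟩ := (Finset.mem_filter.1 he).2
    exact ⟨x, y, h1, (hT.1.1 _ _ h2).2.1, h3⟩
  · ext ⟨i, j⟩
    rw [mem_TT]
    constructor
    · rintro ⟨x, y, rfl, rfl, h1, h2 | ⟨h2, h3⟩⟩
      · obtain ⟨u, v, e1, e2, e3⟩ := (Finset.mem_filter.1 h2).2
        have := (hT.1.1 _ _ e2).2.1
        obtain ⟨rfl, rfl⟩ := (pair_eq_iff (by rw [Fin.lt_def]; omega)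
          (by rw [Fin.lt_def]; omega)).1 e1
        exact e2
      · rw [h2, h3]
        exact hT.2.2 (by omega)
    · intro h
      have h1 := hT.1.1 _ _ h
      refine ⟨⟨i, by omega⟩, ⟨j, by omega⟩, rfl, rfl, h1.2.1, ?_⟩
      by_cases hr : i = 0 ∧ j = n + 1
      · exact Or.inr hr
      · left
        rw [Finset.mem_filter]
        exact ⟨Finset.mem_univ _, _, _, rfl, h, hr⟩

theorem D34_eq (n m : ℕ) : D34 n m = {t : Tr | t.sz = n + 1 ∧ t.nc = m}.ncard := by
  rw [← tree_ncard]
  unfold D34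
  rw [← Set.InjOn.ncard_image (f := TT n)]
  · congr 1
    ext T
    simp only [Set.mem_image, Set.mem_ofPred_eq]
    constructor
    · rintro ⟨S, ⟨h1, h2, h3⟩, rfl⟩
      exact ⟨(cells_iff h1).1 h2, by rw [← numCells_eq h1, h3]⟩
    · rintro ⟨h1, h2⟩
      obtain ⟨S, hS, rfl⟩ := TT_surj h1
      have hD := isDissection_iff.2 ⟨hS, h1.1.2.1⟩
      exact ⟨S, ⟨hD, (cells_iff hD).2 h1, by rw [numCells_eq hD, h2]⟩, rfl⟩
  · rintro S ⟨h1, _⟩ S' ⟨h2, _⟩ h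
    exact Finset.Subset.antisymm (TT_inj (isDissection_iff.1 h1).1 h)
      (TT_inj (isDissection_iff.1 h2).1 h.symm)

/-- The weight of a tree. -/
noncomputable def Tr.wt : Tr → (Fin 2 →₀ ℕ)
  | .leaf => 0
  | .tri s t => (Finsupp.single 1 1 + Finsupp.single 0 1) + (s.wt + t.wt)
  | .quad s t u => (Finsupp.single 1 1 + Finsupp.single 0 2) + (s.wt + (t.wt + u.wt))

theorem Tr.wt_spec (t : Tr) : t.sz = t.wt 0 + 1 ∧ t.nc = t.wt 1 := by
  induction t with
  | leaf => simp [Tr.sz, Tr.nc, Tr.wt]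
  | tri s t hs ht => simp [Tr.sz, Tr.nc, Tr.wt]; omega
  | quad s t u hs ht hu => simp [Tr.sz, Tr.nc, Tr.wt]; omega

theorem wt_set (d : Fin 2 →₀ ℕ) :
    {t : Tr | t.sz = d 0 + 1 ∧ t.nc = d 1} = {t : Tr | t.wt = d} := by
  ext t
  have := t.wt_spec
  simp only [Set.mem_ofPred_eq, Finsupp.ext_iff, Fin.forall_fin_two]
  omega

/-- Generating function of a weighted type. -/
noncomputable def gf {A : Type} (f : A → (Fin 2 →₀ ℕ)) : MvPowerSeries (Fin 2) ℚ :=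
  fun d => ({a | f a = d}.ncard : ℚ)

theorem coeff_gf {A : Type} (f : A → (Fin 2 →₀ ℕ)) (d : Fin 2 →₀ ℕ) :
    MvPowerSeries.coeff d (gf f) = ({a | f a = d}.ncard : ℚ) := rfl

def FF {A : Type} (f : A → (Fin 2 →₀ ℕ)) : Prop := ∀ d, {a | f a = d}.Finite

theorem fiber_prod {A B : Type} (f : A → (Fin 2 →₀ ℕ)) (g : B → (Fin 2 →₀ ℕ))
    (d : Fin 2 →₀ ℕ) : {p : A × B | f p.1 + g p.2 = d} =
      ⋃ x ∈ Finset.HasAntidiagonal.antidiagonal d, ({a | f a = x.1} ×ˢ {b | g b = x.2}) := by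
  ext ⟨a, b⟩
  simp only [Set.mem_ofPred_eq, Set.mem_iUnion, Set.mem_prod, Finset.HasAntidiagonal.mem_antidiagonal]
  constructor
  · intro h
    exact ⟨(f a, g b), h, rfl, rfl⟩
  · rintro ⟨⟨x, y⟩, h, h1, h2⟩
    simp only at h h1 h2
    rw [h1, h2, h]

theorem FF_prod {A B : Type} {f : A → (Fin 2 →₀ ℕ)} {g : B → (Fin 2 →₀ ℕ)}
    (hf : FF f) (hg : FF g) : FF (fun p : A × B => f p.1 + g p.2) := by
  intro d
  rw [fiber_prod]
  exact Set.Finite.biUnion (Finset.finite_toSet _) (fun x _ => (hf _).prod (hg _))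

theorem gf_prod {A B : Type} {f : A → (Fin 2 →₀ ℕ)} {g : B → (Fin 2 →₀ ℕ)}
    (hf : FF f) (hg : FF g) : gf (fun p : A × B => f p.1 + g p.2) = gf f * gf g := by
  classical
  ext d
  rw [MvPowerSeries.coeff_mul, coeff_gf, fiber_prod]
  have : (⋃ x ∈ Finset.HasAntidiagonal.antidiagonal d, ({a | f a = x.1} ×ˢ {b | g b = x.2})) =
      (((Finset.HasAntidiagonal.antidiagonal d).biUnion
        (fun x => (hf x.1).toFinset ×ˢ (hg x.2).toFinset) : Finset (A × B)) : Set (A × B)) := by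
    ext ⟨a, b⟩
    simp
  rw [this, Set.ncard_coe_finset, Finset.card_biUnion]
  · push_cast
    refine Finset.sum_congr rfl fun x _ => ?_
    rw [Finset.card_product, coeff_gf, coeff_gf, Set.ncard_eq_toFinset_card _ (hf _),
      Set.ncard_eq_toFinset_card _ (hg _)]
    push_cast
    rfl
  · intro x _ y _ hxy
    rw [Function.onFun, Finset.disjoint_left]
    rintro ⟨a, b⟩ h1 h2
    simp at h1 h2
    apply hxy
    ext1
    · rw [← h1.1, ← h2.1]
    · rw [← h1.2, ← h2.2]

theorem FF_const {A : Type} {f : A → (Fin 2 →₀ ℕ)} (e : Fin 2 →₀ ℕ) (hf : FF f) :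
    FF (fun a => e + f a) := by
  intro d
  refine (hf (d - e)).subset ?_
  intro a ha
  simp only [Set.mem_ofPred_eq] at *
  rw [← ha, add_tsub_cancel_left]

theorem gf_const {A : Type} {f : A → (Fin 2 →₀ ℕ)} (e : Fin 2 →₀ ℕ) :
    gf (fun a => e + f a) = MvPowerSeries.monomial e (1 : ℚ) * gf f := by
  classical
  ext d
  rw [MvPowerSeries.coeff_monomial_mul, coeff_gf]
  split_ifs with h
  · rw [coeff_gf, one_mul]
    congr 2
    ext a
    simp only [Set.mem_ofPred_eq]
    constructor
    · intro ha
      rw [← ha, add_tsub_cancel_left]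
    · intro ha
      rw [ha, add_tsub_cancel_of_le h]
  · have : {a | e + f a = d} = ∅ := by
      ext a
      simp only [Set.mem_ofPred_eq, Set.mem_empty_iff_false, iff_false]
      rintro rfl
      exact h le_self_add
    rw [this]; simp

theorem FF_wt : FF Tr.wt := by
  intro d
  rw [← wt_set]
  exact tree_finite _ _

theorem D34gf_eq : D34gf = gf Tr.wt := by
  ext d
  rw [coeff_gf, ← wt_set, ← D34_eq]
  rfl

theorem gf_tree : gf Tr.wt = 1 + gf (fun p : Tr × Tr => (Tr.tri p.1 p.2).wt) +
    gf (fun p : Tr × (Tr × Tr) => (Tr.quad p.1 p.2.1 p.2.2).wt) := by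
  classical
  ext d
  rw [map_add, map_add, coeff_gf, coeff_gf, coeff_gf]
  have h1 : {t : Tr | t.wt = d} = ({t | t = Tr.leaf ∧ d = 0} ∪
      (fun p : Tr × Tr => Tr.tri p.1 p.2) '' {p | (Tr.tri p.1 p.2).wt = d}) ∪
      (fun p : Tr × (Tr × Tr) => Tr.quad p.1 p.2.1 p.2.2) ''
        {p | (Tr.quad p.1 p.2.1 p.2.2).wt = d} := by
    ext t
    cases t with
    | leaf => simp [Tr.wt, eq_comm]
    | tri s t => simp
    | quad s t u => simp
  have hf := FF_wt d
  have hf' := hf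
  rw [h1] at hf'
  have f3 := hf'.subset Set.subset_union_right
  have f12 := hf'.subset Set.subset_union_left
  have f2 := f12.subset Set.subset_union_right
  have f1 := f12.subset Set.subset_union_left
  rw [h1, Set.ncard_union_eq _ f12 f3, Set.ncard_union_eq _ f1 f2, Set.InjOn.ncard_image,
    Set.InjOn.ncard_image]
  · push_cast
    congr 2
    rw [MvPowerSeries.coeff_one]
    split_ifs with h
    · simp [h]
    · simp [h]
  · rintro ⟨a, b, c⟩ _ ⟨a', b', c'⟩ _ h
    simpa using h
  · rintro ⟨a, b⟩ _ ⟨a', b'⟩ _ h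
    simpa using h
  · rw [Set.disjoint_left]
    rintro t ⟨rfl, _⟩ ⟨p, _, h⟩
    simp at h
  · rw [Set.disjoint_left]
    rintro t (⟨rfl, _⟩ | ⟨p, _, rfl⟩) ⟨q, _, h⟩
    · simp at h
    · simp at h

/-- The generating function of dissections into triangles and quadrilaterals
satisfies `D = 1 + w z D^2 + w z^2 D^3`. -/
theorem tri_quad_gf_functional_equation :
    D34gf = 1 +
      MvPowerSeries.X (1 : Fin 2) * MvPowerSeries.X (0 : Fin 2) * D34gf ^ 2 +
      MvPowerSeries.X (1 : Fin 2) * MvPowerSeries.X (0 : Fin 2) ^ 2 * D34gf ^ 3 := by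
  rw [D34gf_eq]
  have e1 : gf (fun p : Tr × Tr => (Tr.tri p.1 p.2).wt) =
      MvPowerSeries.X (1 : Fin 2) * MvPowerSeries.X (0 : Fin 2) * gf Tr.wt ^ 2 := by
    simp only [Tr.wt]
    rw [gf_const (f := fun p : Tr × Tr => p.1.wt + p.2.wt), gf_prod FF_wt FF_wt, pow_two,
      MvPowerSeries.X, MvPowerSeries.X, MvPowerSeries.monomial_mul_monomial, one_mul]
  have e2 : gf (fun p : Tr × (Tr × Tr) => (Tr.quad p.1 p.2.1 p.2.2).wt) =
      MvPowerSeries.X (1 : Fin 2) * MvPowerSeries.X (0 : Fin 2) ^ 2 * gf Tr.wt ^ 3 := by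
    simp only [Tr.wt]
    rw [gf_const (f := fun p : Tr × (Tr × Tr) => p.1.wt + (p.2.1.wt + p.2.2.wt)),
      gf_prod FF_wt (g := fun p : Tr × Tr => p.1.wt + p.2.wt) (FF_prod FF_wt FF_wt),
      gf_prod FF_wt FF_wt, MvPowerSeries.X_pow_eq, MvPowerSeries.X,
      MvPowerSeries.monomial_mul_monomial, one_mul]
    ring
  conv_lhs => rw [gf_tree]
  rw [e1, e2]

end PolygonDissection
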